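/- arXiv:1412.0159 — 3 statements merged into one kernel-verified Lean document; each statement's English description precedes it below -/
import Mathlib

section
/- Let φ : ℝⁿ → ℝ be differentiable, j a coordinate, p ∈ ℝⁿ, α > 0, γ > 0, 0 < Δt ≤ 1, and g̃ ∈ ℝ. Set Δp_j := −(g̃/γ)·Δt and p⁺ := p + Δp_j·e_j (e_j the j-th standard basis vector). Suppose that for every p' agreeing with p off coordinate j and with p'_j in the closed interval spanned by p_j and p_j + Δp_j, one has φ(p') − φ(p) − ∇_jφ(p)·(p'_j − p_j) ≤ (γ/α)·(p'_j − p_j)². Then φ(p) − φ(p⁺) ≥ (1 − 1/α)·γ·(Δp_j)²/Δt − |∇_jφ(p) − g̃|·|Δp_j|. -/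
open Set

noncomputable section

namespace AGD

/-- The `j`-th partial derivative of `φ`. -/
def pderiv {n : ℕ} (φ : (Fin n → ℝ) → ℝ) (j : Fin n) (x : Fin n → ℝ) : ℝ :=
  fderiv ℝ φ x (Pi.single j 1)

/-- Lemma 2 (progress of φ at an update): if `Δp_j = −(g̃/γ)·Δt` and the local Lipschitz
bound (Condition A1) holds along the segment of the update, then
`φ(p) − φ(p⁺) ≥ (1 − 1/α)·γ·(Δp_j)²/Δt − |∇_jφ(p) − g̃|·|Δp_j|`. -/
theorem progress_of_phi (n : ℕ) (φ : (Fin n → ℝ) → ℝ) (hφ : Differentiable ℝ φ)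
    (j : Fin n) (p : Fin n → ℝ) (α γ Δt gt Δpj : ℝ)
    (hα : 0 < α) (hγ : 0 < γ) (hΔt : 0 < Δt) (hΔt1 : Δt ≤ 1)
    (hΔpj : Δpj = -(gt / γ) * Δt)
    (hA1 : ∀ s ∈ uIcc (p j) (p j + Δpj),
      φ (Function.update p j s) - φ p - pderiv φ j p * (s - p j) ≤ γ / α * (s - p j) ^ 2) :
    φ p - φ (Function.update p j (p j + Δpj))
      ≥ (1 - 1 / α) * γ * Δpj ^ 2 / Δt - |pderiv φ j p - gt| * |Δpj| := by
  have step := hA1 (p j + Δpj) right_mem_uIcc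
  rw [add_sub_cancel_left] at step
  have gt_mul : gt * Δpj = -(γ * (Δpj ^ 2 / Δt)) := by
    have : gt = -(γ * Δpj / Δt) := by
      rw [hΔpj]
      field_simp
    rw [this]
    ring
  have error_le : (pderiv φ j p - gt) * Δpj ≤ |pderiv φ j p - gt| * |Δpj| :=
    (le_abs_self _).trans_eq (abs_mul _ _)
  have sq_le : γ / α * Δpj ^ 2 ≤ γ / α * (Δpj ^ 2 / Δt) := by
    gcongr
    exact le_div_self (sq_nonneg _) hΔt hΔt1
  have split : (1 - 1 / α) * γ * Δpj ^ 2 / Δt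
      = γ * (Δpj ^ 2 / Δt) - γ / α * (Δpj ^ 2 / Δt) := by
    ring
  rw [split]
  linarith

end AGD
end
end

section
/- Suppose there is an update to p_j at time t by the rule p_j^{t+} = p_j^t·(1 + λ_j·min{z̃_j − κ_j v_j, 1}·Δt_j) with 0 < Δt_j ≤ 1, λ_j ≤ 1/60 and |κ_j v_j| ≤ 1/10, i.e., the change is Δp_j = λ_j p_j·min{z̃_j − κ_j v_j, 1}·Δt_j and γ_j^t := max{1, z̃_j − κ_j v_j}/(λ_j p_j). Let z_j := −∇_jφ(p^t), x_j := z_j + 1, x̃_j := z̃_j + 1 ≥ 0, and assume: (i) whenever |Δp/p_j| ≤ 1/6, φ(p^t + Δp·e_j) − φ(p^t) − ∇_jφ(p^t)·Δp ≤ (1.5·x_j/p_j)·Δp²; and (ii) x_j ≤ 1.24·x̃_j. Let φ⁻ = φ(p^t) and φ⁺ = φ(p^{t+}). Then both of the following hold: φ⁻ − φ⁺ ≥ (1/2)·(z̃_j)²·Δt_j/γ_j^t − (1/2)·(κ_j v_j)²·Δt_j/γ_j^t − |z_j − z̃_j|·|Δp_j|, and φ⁻ − φ⁺ ≥ (41/60)·γ_j^t·(Δp_j)²/Δt_j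 − (κ_j v_j)²·Δt_j/γ_j^t − |z_j − z̃_j|·|Δp_j|. -/
open Set

noncomputable section

namespace AGD

theorem abs_min_sub_one_le {a k : ℝ} (hk : |k| ≤ 1 / 10) (ha : 0 ≤ a + 1) :
    |min (a - k) 1| ≤ 11 / 10 := by
  obtain ⟨hk₁, hk₂⟩ := abs_le.mp hk
  rw [abs_le]
  exact ⟨le_min (by linarith) (by norm_num), (min_le_right _ _).trans (by norm_num)⟩

/-- The curvature bound at a clipped step is absorbed by a small multiple of `γ (Δp)² / Δt`. -/
theorem quadratic_term_le {a k x l q t m M : ℝ} (hk : |k| ≤ 1 / 10) (hM₁ : 1 ≤ M)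
    (haM : a - k ≤ M) (hx : x ≤ 1.24 * (a + 1)) (hl0 : 0 < l) (hl : l ≤ 1 / 60)
    (hq : 0 < q) (ht0 : 0 < t) (ht1 : t ≤ 1) :
    1.5 * x / q * (l * q * m * t) ^ 2 ≤ 0.0651 * (M * m ^ 2 * (l * q * t)) := by
  obtain ⟨-, hk₂⟩ := abs_le.mp hk
  have hlt : l * t ≤ 1 / 60 := by nlinarith
  have hlt0 : 0 < l * t := mul_pos hl0 ht0
  have hxM : x ≤ 1.24 * 2.1 * M := by linarith
  have hcoef : 1.5 * x * (l * t) ≤ 0.0651 * M := by nlinarith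
  have hnonneg : 0 ≤ m ^ 2 * (l * q * t) := by positivity
  calc 1.5 * x / q * (l * q * m * t) ^ 2
      = 1.5 * x * (l * t) * (m ^ 2 * (l * q * t)) := by field_simp
    _ ≤ 0.0651 * M * (m ^ 2 * (l * q * t)) := mul_le_mul_of_nonneg_right hcoef hnonneg
    _ = 0.0651 * (M * m ^ 2 * (l * q * t)) := by ring

/-- Lemma 12 (progress of `φ` at a warehouse-tatonnement update): for an update
`p_j^{t+} = p_j^t·(1 + λ_j·min{z̃_j − κ_j v_j, 1}·Δt_j)` with `λ_j ≤ 1/60` and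
`|κ_j v_j| ≤ 1/10`, writing `γ_j^t = max{1, z̃_j − κ_j v_j}/(λ_j p_j)`,
`φ⁻ − φ⁺ ≥ ½(z̃_j)²Δt_j/γ_j^t − ½(κ_j v_j)²Δt_j/γ_j^t − |z_j − z̃_j|·|Δp_j|` and
`φ⁻ − φ⁺ ≥ (41/60)·γ_j^t·(Δp_j)²/Δt_j − (κ_j v_j)²Δt_j/γ_j^t − |z_j − z̃_j|·|Δp_j|`. -/
theorem progress_of_phi_with_warehouse (n : ℕ) (φ : (Fin n → ℝ) → ℝ)
    (hdiff : Differentiable ℝ φ) (hconv : ConvexOn ℝ Set.univ φ)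
    (p : Fin n → ℝ) (hp : ∀ k, 0 < p k) (j : Fin n)
    (lamj κj vj ztj Δtj : ℝ)
    (hΔt0 : 0 < Δtj) (hΔt1 : Δtj ≤ 1)
    (hlam0 : 0 < lamj) (hlam : lamj ≤ 1 / 60)
    (hκv : |κj * vj| ≤ 1 / 10)
    (Δpj γjt zj xj xtj : ℝ)
    (hΔpj : Δpj = lamj * p j * min (ztj - κj * vj) 1 * Δtj)
    (hγjt : γjt = max 1 (ztj - κj * vj) / (lamj * p j))
    (hzj : zj = -pderiv φ j p) (hxj : xj = zj + 1) (hxtj : xtj = ztj + 1)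
    (hxtj0 : 0 ≤ xtj)
    (hA1 : ∀ Δ : ℝ, |Δ / p j| ≤ 1 / 6 →
      φ (Function.update p j (p j + Δ)) - φ p - pderiv φ j p * Δ ≤ 1.5 * xj / p j * Δ ^ 2)
    (hx : xj ≤ 1.24 * xtj) :
    φ p - φ (Function.update p j (p j + Δpj))
        ≥ 1 / 2 * ztj ^ 2 * Δtj / γjt - 1 / 2 * (κj * vj) ^ 2 * Δtj / γjt
          - |zj - ztj| * |Δpj| ∧
    φ p - φ (Function.update p j (p j + Δpj))
        ≥ 41 / 60 * γjt * Δpj ^ 2 / Δtj - (κj * vj) ^ 2 * Δtj / γjt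
          - |zj - ztj| * |Δpj| := by
  subst hxtj hΔpj hγjt
  set k := κj * vj
  set q := p j
  have hq : 0 < q := hp j
  have hm := abs_min_sub_one_le hκv hxtj0
  have hmM : min (ztj - k) 1 * max 1 (ztj - k) = ztj - k := by
    rw [max_comm, min_mul_max, mul_one]
  have hM₁ : 1 ≤ max 1 (ztj - k) := le_max_left _ _
  have haM : ztj - k ≤ max 1 (ztj - k) := le_max_right _ _
  generalize min (ztj - k) 1 = m at *
  generalize max 1 (ztj - k) = M at *
  have hM : 0 < M := by linarith
  have hstep : |lamj * q * m * Δtj / q| ≤ 1 / 6 := by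
    rw [show lamj * q * m * Δtj / q = lamj * Δtj * m by field_simp, abs_mul,
      abs_of_pos (mul_pos hlam0 hΔt0)]
    have hlt : lamj * Δtj ≤ 1 / 60 := by nlinarith
    nlinarith [abs_nonneg m]
  have hφ := hA1 _ hstep
  have hquad := quadratic_term_le (m := m) hκv hM₁ haM hx hlam0 hlam hq hΔt0 hΔt1
  have herr : -(|zj - ztj| * |lamj * q * m * Δtj|) ≤ (zj - ztj) * (lamj * q * m * Δtj) := by
    rw [← abs_mul]
    exact neg_abs_le _
  have hdecr : ztj * m * (lamj * q * Δtj) - 0.0651 * (M * m ^ 2 * (lamj * q * Δtj))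
      - |zj - ztj| * |lamj * q * m * Δtj| ≤
      φ p - φ (Function.update p j (q + lamj * q * m * Δtj)) := by
    have hderiv : pderiv φ j p = -zj := by linarith
    rw [hderiv] at hφ
    linarith
  have hs : 0 < lamj * q * Δtj := by positivity
  have hw : ztj = k + m * M := by linarith
  constructor
  · have hmain : 1 / 2 * ztj ^ 2 * Δtj / (M / (lamj * q)) - 1 / 2 * k ^ 2 * Δtj / (M / (lamj * q))
        = (ztj * m - 1 / 2 * (M * m ^ 2)) * (lamj * q * Δtj) := by
      rw [hw]
      field_simp
      ring
    rw [hmain]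
    have : 0 ≤ M * m ^ 2 * (lamj * q * Δtj) := by positivity
    linarith
  · have hmain : 41 / 60 * (M / (lamj * q)) * (lamj * q * m * Δtj) ^ 2 / Δtj
          - k ^ 2 * Δtj / (M / (lamj * q))
        = (41 / 60 * (M * m ^ 2) - k ^ 2 / M) * (lamj * q * Δtj) := by
      field_simp
    rw [hmain]
    have hsq : 0 ≤ ztj * m - 0.0651 * (M * m ^ 2) - (41 / 60 * (M * m ^ 2) - k ^ 2 / M) := by
      have heq : ztj * m - 0.0651 * (M * m ^ 2) - (41 / 60 * (M * m ^ 2) - k ^ 2 / M)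
          = ((k + m * M / 2) ^ 2 + (1 - 0.0651 - 41 / 60 - 1 / 4) * (m * M) ^ 2) / M := by
        rw [hw]
        field_simp
        ring
      rw [heq]
      apply div_nonneg _ hM.le
      have h₁ := sq_nonneg (k + m * M / 2)
      have h₂ := sq_nonneg (m * M)
      linarith
    have := mul_nonneg hsq hs.le
    linarith

end AGD
end
end

section
/- Let φ : ℝⁿ → ℝ be a twice continuously differentiable function, p* ∈ ℝⁿ with all coordinates positive, ∇φ(p*) = 0 and φ(p*) = 0, and let θ̄ ∈ [0, 1). Let R(1.9) := {p' ∈ ℝⁿ : p*_j/1.9 ≤ p'_j ≤ 1.9·p*_j for all j}. Suppose that for every p' ∈ R(1.9) the Hessian of φ at p' majorizes the diagonal matrix with j-th diagonal entry (1 − θ̄)/(3.61·p*_j) (i.e., their difference is positive semidefinite). Then for every p' ∈ R(1.9), φ(p') ≥ ((1 − θ̄)/13.28)·Σ_j p*_j·(ln(p'_j/p*_j))². -/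
open Set

noncomputable section

namespace AGD

/-- The `(k, ℓ)` entry of the Hessian of `φ` at `x`. -/
def hess {n : ℕ} (φ : (Fin n → ℝ) → ℝ) (k ℓ : Fin n) (x : Fin n → ℝ) : ℝ :=
  fderiv ℝ (pderiv φ ℓ) x (Pi.single k 1)

theorem fderiv_apply_eq_sum_single {n : ℕ} (φ : (Fin n → ℝ) → ℝ) (x v : Fin n → ℝ) :
    fderiv ℝ φ x v = ∑ j, v j * fderiv ℝ φ x (Pi.single j 1) := by
  conv_lhs => rw [pi_eq_sum_univ' v]
  simp [map_sum]

theorem hasDerivAt_comp_line {n : ℕ} {φ : (Fin n → ℝ) → ℝ} (hφ : Differentiable ℝ φ)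
    (x v : Fin n → ℝ) (t : ℝ) :
    HasDerivAt (fun s : ℝ => φ (x + s • v))
      (∑ j, v j * fderiv ℝ φ (x + t • v) (Pi.single j 1)) t := by
  rw [← fderiv_apply_eq_sum_single]
  have hline : HasDerivAt (fun s : ℝ => x + s • v) v t := by
    simpa using ((hasDerivAt_id t).smul_const v).const_add x
  exact (hφ _).hasFDerivAt.comp_hasDerivAt t hline

theorem differentiable_pderiv {n : ℕ} {φ : (Fin n → ℝ) → ℝ} (hφ : ContDiff ℝ 2 φ)
    (j : Fin n) : Differentiable ℝ (pderiv φ j) := by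
  have h : ContDiff ℝ 1 (fderiv ℝ φ) := hφ.fderiv_right (by norm_num)
  exact (h.clm_apply contDiff_const).differentiable one_ne_zero

theorem le_of_hasDerivAt_nonneg {f f' : ℝ → ℝ} (hf : ∀ t, HasDerivAt f (f' t) t)
    (hf' : ∀ t ∈ Icc (0 : ℝ) 1, 0 ≤ f' t) {t : ℝ} (ht : t ∈ Icc (0 : ℝ) 1) : f 0 ≤ f t := by
  have hmono : MonotoneOn f (Icc 0 1) := by
    refine monotoneOn_of_deriv_nonneg (convex_Icc 0 1)
      (fun s _ => (hf s).continuousAt.continuousWithinAt)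
      (fun s _ => (hf s).differentiableAt.differentiableWithinAt) fun s hs => ?_
    rw [(hf s).deriv]
    exact hf' s (interior_subset hs)
  exact hmono (left_mem_Icc.2 zero_le_one) ht ht.1

/-- Second-order Taylor lower bound on `[0, 1]` from a critical point. -/
theorem half_le_sub_of_le_second_deriv {f f' f'' : ℝ → ℝ} {K : ℝ}
    (hf : ∀ t, HasDerivAt f (f' t) t) (hf' : ∀ t, HasDerivAt f' (f'' t) t)
    (h0 : f' 0 = 0) (hK : ∀ t ∈ Icc (0 : ℝ) 1, K ≤ f'' t) : K / 2 ≤ f 1 - f 0 := by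
  have h1 : ∀ t ∈ Icc (0 : ℝ) 1, 0 ≤ f' t - K * t := fun t ht => by
    have := le_of_hasDerivAt_nonneg (f := fun s => f' s - K * s) (f' := fun s => f'' s - K * 1)
      (fun s => (hf' s).sub ((hasDerivAt_id s).const_mul K))
      (fun s hs => by linarith [hK s hs]) ht
    simpa [h0] using this
  have h2 := le_of_hasDerivAt_nonneg (f := fun s => f s - K / 2 * s ^ 2)
    (f' := fun s => f' s - K / 2 * (2 * s))
    (fun s => (hf s).sub (by simpa using (hasDerivAt_pow 2 s).const_mul (K / 2)))
    (fun s hs => by linarith [h1 s hs]) (right_mem_Icc.2 zero_le_one)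
  norm_num at h2
  linarith

theorem log_nineteen_tenths_le : Real.log 1.9 ≤ 1.356 * (9 / 19) := by
  rw [Real.log_le_iff_le_exp (by norm_num)]
  refine le_trans ?_ (Real.sum_le_exp_of_nonneg (by norm_num) 7)
  norm_num [Finset.sum_range_succ, Nat.factorial]

theorem log_sq_le_of_one_div_le {x : ℝ} (hl : 1 / 1.9 ≤ x) :
    Real.log x ^ 2 ≤ 13.28 / 7.22 * (x - 1) ^ 2 := by
  have hx : 0 < x := lt_of_lt_of_le (by norm_num) hl
  rcases le_total 1 x with h | h
  · have h1 := Real.log_le_sub_one_of_pos hx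
    have h2 := Real.log_nonneg h
    nlinarith [sq_nonneg (x - 1)]
  · -- The graph of the concave function `log` lies above its chord over `[1 / 1.9, 1]`.
    have hchord : 1.356 * (x - 1) ≤ Real.log x := by
      have hc := strictConcaveOn_log_Ioi.concaveOn.2
        (show (1 / 1.9 : ℝ) ∈ Ioi 0 by norm_num) (show (1 : ℝ) ∈ Ioi 0 by norm_num)
        (show 0 ≤ (1 - x) * (19 / 9) by linarith)
        (show 0 ≤ 1 - (1 - x) * (19 / 9) by norm_num at hl ⊢; linarith) (by ring)
      have hlog : Real.log (1 / 1.9) = -Real.log 1.9 := by rw [one_div, Real.log_inv]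
      have hx' : (1 - x) * (19 / 9) * (1 / 1.9) + (1 - (1 - x) * (19 / 9)) = x := by ring
      simp only [smul_eq_mul, mul_one, Real.log_one, mul_zero, add_zero, hlog, hx'] at hc
      nlinarith [mul_le_mul_of_nonneg_left log_nineteen_tenths_le (sub_nonneg.2 h)]
    have h2 := Real.log_nonpos hx.le h
    nlinarith [sq_nonneg (x - 1)]

/-- Lemma 18: let `φ` be `C²` with `∇φ(p*) = 0`, `φ(p*) = 0`, all `p*_j > 0`, and
`θ̄ ∈ [0,1)`.  If on the box `R(1.9) = {p' | p*_j/1.9 ≤ p'_j ≤ 1.9·p*_j}` the Hessian of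
`φ` majorizes the diagonal matrix `diag((1−θ̄)/(3.61·p*_j))`, then for every `p' ∈ R(1.9)`,
`φ(p') ≥ ((1−θ̄)/13.28)·Σ_j p*_j·(ln(p'_j/p*_j))²`. -/
theorem phi_convexity_log_bound (n : ℕ) (φ : (Fin n → ℝ) → ℝ) (hφ : ContDiff ℝ 2 φ)
    (ps : Fin n → ℝ) (hps : ∀ j, 0 < ps j)
    (hgrad : ∀ j, pderiv φ j ps = 0) (hmin : φ ps = 0)
    (θ : ℝ) (hθ0 : 0 ≤ θ) (hθ1 : θ < 1)
    (hhess : ∀ q : Fin n → ℝ, (∀ j, ps j / 1.9 ≤ q j ∧ q j ≤ 1.9 * ps j) →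
      ∀ w : Fin n → ℝ,
        ∑ j, (1 - θ) / (3.61 * ps j) * w j ^ 2 ≤ ∑ j, ∑ k, hess φ j k q * w j * w k) :
    ∀ p' : Fin n → ℝ, (∀ j, ps j / 1.9 ≤ p' j ∧ p' j ≤ 1.9 * ps j) →
      φ p' ≥ (1 - θ) / 13.28 * ∑ j, ps j * Real.log (p' j / ps j) ^ 2 := by
  intro p' hp'
  set v : Fin n → ℝ := p' - ps with hv
  have hseg : ∀ t ∈ Icc (0 : ℝ) 1, ∀ j,
      ps j / 1.9 ≤ (ps + t • v) j ∧ (ps + t • v) j ≤ 1.9 * ps j := fun t ht j => by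
    obtain ⟨ht0, ht1⟩ := ht
    obtain ⟨hl, hu⟩ := hp' j
    have hpj := hps j
    have hlow : ps j / 1.9 ≤ ps j := div_le_self hpj.le (by norm_num)
    simp only [hv, Pi.add_apply, Pi.smul_apply, Pi.sub_apply, smul_eq_mul]
    constructor <;> nlinarith
  have hTaylor := half_le_sub_of_le_second_deriv
    (f := fun t => φ (ps + t • v))
    (f' := fun t => ∑ j, v j * pderiv φ j (ps + t • v))
    (f'' := fun t => ∑ j, v j * ∑ k, v k * hess φ k j (ps + t • v))
    (K := ∑ j, (1 - θ) / (3.61 * ps j) * v j ^ 2)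
    (hasDerivAt_comp_line (hφ.differentiable two_ne_zero) ps v)
    (fun t => HasDerivAt.fun_sum fun j _ =>
      (hasDerivAt_comp_line (differentiable_pderiv hφ j) ps v t).const_mul (v j))
    (by simp [hgrad])
    (fun t ht => by
      refine (hhess _ (hseg t ht) v).trans_eq ?_
      rw [Finset.sum_comm]
      refine Finset.sum_congr rfl fun j _ => ?_
      rw [Finset.mul_sum]
      exact Finset.sum_congr rfl fun k _ => by ring)
  have hend : ps + v = p' := by simp [hv]
  simp only [one_smul, zero_smul, add_zero, hmin, sub_zero, hend] at hTaylor
  refine le_trans ?_ hTaylor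
  rw [Finset.mul_sum, Finset.sum_div]
  refine Finset.sum_le_sum fun j _ => ?_
  have hpj := hps j
  have hlog := log_sq_le_of_one_div_le (x := p' j / ps j) (by
    rw [le_div_iff₀ hpj, div_mul_eq_mul_div, one_mul]
    exact (hp' j).1)
  have hcoef : 0 ≤ (1 - θ) / 13.28 * ps j :=
    mul_nonneg (div_nonneg (by linarith) (by norm_num)) hpj.le
  calc (1 - θ) / 13.28 * (ps j * Real.log (p' j / ps j) ^ 2)
      = (1 - θ) / 13.28 * ps j * Real.log (p' j / ps j) ^ 2 := by ring
    _ ≤ (1 - θ) / 13.28 * ps j * (13.28 / 7.22 * (p' j / ps j - 1) ^ 2) :=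
        mul_le_mul_of_nonneg_left hlog hcoef
    _ = (1 - θ) / (3.61 * ps j) * v j ^ 2 / 2 := by
        simp only [hv, Pi.sub_apply]
        field_simp
        ring

end AGD
end
end
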